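/- For all positive integers n, p, k with p ≤ n, the generalized q-binomial coefficient (n choose p,k)_q, defined by (n choose p,k)_q = ([n]_q/[k]_q) · Σ_{r≥0} [p choose r]_q [n-p choose r]_q [n-r-1 choose k-r-1]_q q^{(n-p)p + r(r-k)}, is a polynomial in q with nonnegative integer coefficients. -/

import Mathlib

open Finset

/-- The variable `q`, as a rational function over `ℚ`. -/
noncomputable def q : RatFunc ℚ := RatFunc.X

/-- The q-integer `[m]_q = (1 - q^m)/(1 - q)`. -/
noncomputable def qint (m : ℕ) : RatFunc ℚ := (1 - q ^ m) / (1 - q)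

/-- The q-integer for an integer exponent, `[x; q] = (q^x - 1)/(q - 1)`. -/
noncomputable def qintZ (x : ℤ) : RatFunc ℚ := (q ^ x - 1) / (q - 1)

/-- The q-factorial `[m]!_q`. -/
noncomputable def qfac (m : ℕ) : RatFunc ℚ := ∏ i ∈ Finset.range m, qint (i + 1)

/-- The Gaussian q-binomial coefficient `[a choose b]_q`, zero when `b < 0` or `b > a`. -/
noncomputable def qbin (a b : ℤ) : RatFunc ℚ :=
  if 0 ≤ b ∧ b ≤ a then qfac a.toNat / (qfac b.toNat * qfac (a - b).toNat) else 0

/-- The first generalized q-binomial coefficient `(n choose p, k)_q`: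
`([n]_q/[k]_q) · Σ_{r≥0} [p choose r]_q [n-p choose r]_q [n-r-1 choose k-r-1]_q
  q^{(n-p)p + r(r-k)}`. -/
noncomputable def gchoose (n p k : ℕ) : RatFunc ℚ :=
  (qint n / qint k) *
    ∑ r ∈ Finset.range (n + 1),
      qbin p r * qbin ((n : ℤ) - p) r * qbin ((n : ℤ) - r - 1) ((k : ℤ) - r - 1) *
        q ^ (((n : ℤ) - p) * p + (r : ℤ) * ((r : ℤ) - k))


theorem q_ne_zero : q ≠ 0 := RatFunc.X_ne_zero

theorem q_pow_ne_one (m : ℕ) (hm : 0 < m) : q ^ m ≠ 1 := by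
  intro h
  have h2 : algebraMap (Polynomial ℚ) (RatFunc ℚ) (Polynomial.X ^ m)
      = algebraMap (Polynomial ℚ) (RatFunc ℚ) 1 := by
    rw [map_pow, RatFunc.algebraMap_X, map_one]
    exact h
  have h3 := RatFunc.algebraMap_injective ℚ h2
  have h4 := congrArg Polynomial.natDegree h3
  rw [Polynomial.natDegree_X_pow, Polynomial.natDegree_one] at h4
  omega

theorem one_sub_q_ne : (1 : RatFunc ℚ) - q ≠ 0 := by
  have := q_pow_ne_one 1 one_pos
  rw [pow_one] at this
  exact sub_ne_zero.mpr this.symm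

theorem qint_ne (m : ℕ) (hm : 0 < m) : qint m ≠ 0 :=
  div_ne_zero (sub_ne_zero.mpr (q_pow_ne_one m hm).symm) one_sub_q_ne

theorem qint_add (a b : ℕ) : qint (a + b) = qint a + q ^ a * qint b := by
  have := one_sub_q_ne
  unfold qint
  field_simp
  ring

theorem qfac_succ (m : ℕ) : qfac (m + 1) = qfac m * qint (m + 1) := by
  unfold qfac
  rw [Finset.prod_range_succ]

theorem qfac_ne (m : ℕ) : qfac m ≠ 0 := by
  unfold qfac
  exact Finset.prod_ne_zero_iff.mpr fun i _ => qint_ne _ (Nat.succ_pos i)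

theorem qfac_zero : qfac 0 = 1 := by simp [qfac]

theorem qbin_eq (c d : ℕ) (x y : ℤ) (hx : x = c + d) (hy : y = c) :
    qbin x y = qfac (c + d) / (qfac c * qfac d) := by
  subst hx hy
  unfold qbin
  rw [if_pos (by omega)]
  have h1 : ((c : ℤ) + d).toNat = c + d := by omega
  have h2 : ((c : ℤ) + d - c).toNat = d := by omega
  rw [h1, h2, Int.toNat_natCast]

theorem qbin_zero (x y : ℤ) (h : ¬ (0 ≤ y ∧ y ≤ x)) : qbin x y = 0 := if_neg h

theorem qbin_self (x : ℤ) (hx : 0 ≤ x) : qbin x x = 1 := by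
  obtain ⟨c, rfl⟩ := Int.eq_ofNat_of_zero_le hx
  rw [qbin_eq c 0 _ _ (by simp) rfl, qfac_zero, mul_one, add_zero, div_self (qfac_ne _)]

theorem qbin_symm (x y : ℤ) : qbin x (x - y) = qbin x y := by
  by_cases h : 0 ≤ y ∧ y ≤ x
  · obtain ⟨c, hc⟩ := Int.eq_ofNat_of_zero_le h.1
    obtain ⟨d, hd⟩ := Int.eq_ofNat_of_zero_le (sub_nonneg.mpr h.2)
    rw [qbin_eq c d x y (by omega) (by omega), qbin_eq d c x (x - y) (by omega) (by omega),
      add_comm d c, mul_comm (qfac d)]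
  · rw [qbin_zero _ _ h, qbin_zero _ _ (by omega)]

theorem qbin_right_zero (x : ℤ) (hx : 0 ≤ x) : qbin x 0 = 1 := by
  rw [← qbin_symm, sub_zero, qbin_self x hx]

theorem qbin_pascal (n : ℕ) (k : ℤ) :
    qbin ((n : ℤ) + 1) k = qbin n (k - 1) + q ^ k * qbin n k := by
  by_cases h0 : k < 0
  · rw [qbin_zero _ _ (by omega), qbin_zero _ _ (by omega), qbin_zero _ _ (by omega)]; simp
  by_cases h1 : k = 0
  · subst h1
    rw [qbin_right_zero _ (by omega), qbin_right_zero _ (by omega), qbin_zero _ _ (by omega)]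
    simp
  by_cases h2 : k = n + 1
  · subst h2
    rw [qbin_self _ (by omega), qbin_zero (n : ℤ) (n + 1) (by omega), add_sub_cancel_right,
      qbin_self _ (by omega)]
    simp
  by_cases h3 : (n : ℤ) + 1 < k
  · rw [qbin_zero _ _ (by omega), qbin_zero _ _ (by omega), qbin_zero _ _ (by omega)]; simp
  obtain ⟨c, hc⟩ := Int.eq_ofNat_of_zero_le (show 0 ≤ k - 1 by omega)
  obtain ⟨d, hd⟩ := Int.eq_ofNat_of_zero_le (show 0 ≤ n - k by omega)
  rw [qbin_eq (c + 1) (d + 1) _ k (by omega) (by omega),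
    qbin_eq c (d + 1) _ (k - 1) (by omega) (by omega),
    qbin_eq (c + 1) d _ k (by omega) (by omega)]
  have hk : k = ((c + 1 : ℕ) : ℤ) := by omega
  rw [hk, zpow_natCast]
  have e1 : qfac (c + 1 + (d + 1)) = qfac (c + d + 1) * (qint (c + 1) + q ^ (c + 1) * qint (d + 1)) := by
    rw [← qint_add, show c + 1 + (d + 1) = (c + d + 1) + 1 by ring, qfac_succ]
  rw [e1, show c + (d + 1) = c + d + 1 by ring, show c + 1 + d = c + d + 1 by ring,
    qfac_succ c, qfac_succ d]
  have := qfac_ne c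
  have := qfac_ne d
  have := qint_ne (c + 1) (by omega)
  have := qint_ne (d + 1) (by omega)
  field_simp

theorem qbin_pascal' (n : ℕ) (k : ℤ) :
    qbin ((n : ℤ) + 1) k = qbin n k + q ^ ((n : ℤ) + 1 - k) * qbin n (k - 1) := by
  rw [← qbin_symm, qbin_pascal, ← qbin_symm n k, ← qbin_symm n (k - 1),
    show (n : ℤ) + 1 - k - 1 = n - k by ring, show (n : ℤ) - (k - 1) = n + 1 - k by ring]

theorem qbin_zero_left (y : ℤ) (h : y ≠ 0) : qbin 0 y = 0 := qbin_zero _ _ (by omega)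

/-- q-Vandermonde, first form, with a shift. -/
theorem vander (n N : ℕ) (R : ℤ) (hR : 0 ≤ R) (hN : R + n < N) (m : ℕ) : ∀ K : ℤ,
    qbin ((m : ℤ) + n) (K - R) = ∑ s ∈ Finset.range N,
      qbin m (K - s) * qbin n (s - R) * q ^ (((s : ℤ) - R) * (m - K + s)) := by
  induction m with
  | zero =>
    intro K
    rw [Nat.cast_zero, zero_add]
    by_cases hK : 0 ≤ K ∧ K < N
    · obtain ⟨c, rfl⟩ := Int.eq_ofNat_of_zero_le hK.1
      rw [Finset.sum_eq_single c]
      · simp [qbin_self]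
      · intro b _ hb
        rw [qbin_zero_left _ (by omega)]; simp
      · intro h
        exact absurd (Finset.mem_range.mpr (by omega)) h
    · rw [qbin_zero _ _ (by omega), Finset.sum_eq_zero]
      intro s hs
      rw [Finset.mem_range] at hs
      rw [qbin_zero_left _ (by omega)]; simp
  | succ m ih =>
    intro K
    have h := qbin_pascal (m + n) (K - R)
    push_cast at h
    push_cast
    rw [show (m : ℤ) + 1 + n = m + n + 1 by ring, h, show K - R - 1 = (K - 1) - R by ring,
      ih, ih, Finset.mul_sum, ← Finset.sum_add_distrib]
    refine Finset.sum_congr rfl fun s _ => ?_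
    rw [qbin_pascal, show K - 1 - (s : ℤ) = K - s - 1 by ring]
    have e1 : q ^ (((s : ℤ) - R) * (m - (K - 1) + s)) = q ^ (((s : ℤ) - R) * (m + 1 - K + s)) := by
      congr 1; ring
    have e2 : q ^ (K - R) * q ^ (((s : ℤ) - R) * (m - K + s))
        = q ^ (K - s) * q ^ (((s : ℤ) - R) * (m + 1 - K + s)) := by
      rw [← zpow_add₀ q_ne_zero, ← zpow_add₀ q_ne_zero]; congr 1; ring
    rw [e1]
    linear_combination (qbin m (K - s) * qbin n (s - R)) * e2

/-- q-Vandermonde, second form. -/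
theorem vander' (n N : ℕ) (hN : n < N) (m : ℕ) : ∀ K : ℤ,
    qbin ((m : ℤ) + n) K = ∑ s ∈ Finset.range N,
      qbin m (K - s) * qbin n s * q ^ ((K - s) * ((n : ℤ) - s)) := by
  induction m with
  | zero =>
    intro K
    rw [Nat.cast_zero, zero_add]
    by_cases hK : 0 ≤ K ∧ K < N
    · obtain ⟨c, rfl⟩ := Int.eq_ofNat_of_zero_le hK.1
      rw [Finset.sum_eq_single c]
      · simp [qbin_self]
      · intro b _ hb
        rw [qbin_zero_left _ (by omega)]; simp
      · intro h
        exact absurd (Finset.mem_range.mpr (by omega)) h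
    · rw [qbin_zero _ _ (by omega), Finset.sum_eq_zero]
      intro s hs
      rw [Finset.mem_range] at hs
      rw [qbin_zero_left _ (by omega)]; simp
  | succ m ih =>
    intro K
    have h := qbin_pascal' (m + n) K
    push_cast at h
    push_cast
    rw [show (m : ℤ) + 1 + n = m + n + 1 by ring, h,
      ih, ih, Finset.mul_sum, ← Finset.sum_add_distrib]
    refine Finset.sum_congr rfl fun s _ => ?_
    rw [qbin_pascal', show K - 1 - (s : ℤ) = K - s - 1 by ring]
    have e2 : q ^ ((m : ℤ) + n + 1 - K) * q ^ ((K - s - 1) * ((n : ℤ) - s))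
        = q ^ ((m : ℤ) + 1 - (K - s)) * q ^ ((K - s) * ((n : ℤ) - s)) := by
      rw [← zpow_add₀ q_ne_zero, ← zpow_add₀ q_ne_zero]; congr 1; ring
    linear_combination (qbin m (K - s - 1) * qbin n s) * e2

theorem qbin_trinom (x y z : ℤ) :
    qbin x y * qbin (x - y) (z - y) = qbin x z * qbin z y := by
  by_cases h : 0 ≤ y ∧ y ≤ z ∧ z ≤ x
  · obtain ⟨c, hc⟩ := Int.eq_ofNat_of_zero_le h.1
    obtain ⟨d, hd⟩ := Int.eq_ofNat_of_zero_le (sub_nonneg.mpr h.2.1)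
    obtain ⟨e, he⟩ := Int.eq_ofNat_of_zero_le (sub_nonneg.mpr h.2.2)
    rw [qbin_eq c (d + e) x y (by omega) (by omega), qbin_eq d e (x - y) _ (by omega) (by omega),
      qbin_eq (c + d) e x z (by omega) (by omega), qbin_eq c d z y (by omega) (by omega), add_assoc]
    have := qfac_ne c
    have := qfac_ne d
    have := qfac_ne e
    have := qfac_ne (d + e)
    have := qfac_ne (c + d)
    field_simp
  · have h1 : qbin x y * qbin (x - y) (z - y) = 0 := by
      by_cases h2 : 0 ≤ y ∧ y ≤ x
      · rw [qbin_zero (x - y) _ (by omega), mul_zero]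
      · rw [qbin_zero x y h2, zero_mul]
    have h3 : qbin x z * qbin z y = 0 := by
      by_cases h2 : 0 ≤ y ∧ y ≤ z
      · rw [qbin_zero x z (by omega), zero_mul]
      · rw [qbin_zero z y h2, mul_zero]
    rw [h1, h3]

/-- absorption -/
theorem qbin_absorb (x y : ℕ) (hx : 0 < x) (hy : 0 < y) :
    qint y * qbin x y = qint x * qbin ((x : ℤ) - 1) ((y : ℤ) - 1) := by
  by_cases h : y ≤ x
  · obtain ⟨d, rfl⟩ := Nat.exists_eq_add_of_le h
    obtain ⟨c, rfl⟩ : ∃ c, y = c + 1 := ⟨y - 1, by omega⟩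
    rw [qbin_eq (c + 1) d _ _ (by push_cast; ring) rfl,
      qbin_eq c d _ _ (by push_cast; ring) (by push_cast; ring),
      show c + 1 + d = c + d + 1 by ring, qfac_succ, qfac_succ]
    have := qfac_ne c
    have := qfac_ne d
    have := qint_ne (c + 1) (by omega)
    field_simp
  · rw [qbin_zero _ _ (by omega), qbin_zero _ _ (by omega)]; simp

theorem qbin_absorb2 (c d : ℕ) (i : ℕ) (hi : 0 < i) (hc : c = i + d) :
    qint i * qbin ((c : ℤ) - 1) i = qint d * qbin ((c : ℤ) - 1) ((i : ℤ) - 1) := by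
  obtain ⟨j, rfl⟩ : ∃ j, i = j + 1 := ⟨i - 1, by omega⟩
  rcases Nat.eq_zero_or_pos d with rfl | hd
  · rw [qbin_zero _ _ (by omega)]; simp [qint]
  · obtain ⟨e, rfl⟩ : ∃ e, d = e + 1 := ⟨d - 1, by omega⟩
    subst hc
    rw [qbin_eq (j + 1) e _ _ (by push_cast; ring) rfl,
      qbin_eq j (e + 1) _ _ (by push_cast; ring) (by push_cast; ring),
      show j + 1 + e = j + e + 1 by ring, show j + (e + 1) = j + e + 1 by ring,
      qfac_succ j, qfac_succ e]
    have := qfac_ne j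
    have := qfac_ne e
    have := qint_ne (j + 1) (by omega)
    have := qint_ne (e + 1) (by omega)
    field_simp

/-- The sum in the definition, transformed. -/
theorem sum_transform (a b k : ℕ) (ha : 0 < a) :
    ∑ r ∈ Finset.range (a + b + 1),
      qbin a r * qbin b r * qbin ((a : ℤ) + b - r - 1) ((k : ℤ) - r - 1) *
        q ^ ((b : ℤ) * a + (r : ℤ) * ((r : ℤ) - k)) =
    ∑ i ∈ Finset.range (a + b + 1),
      qbin k i * qbin ((a : ℤ) - 1) ((i : ℤ) - 1) * qbin ((b : ℤ) + i - 1) ((k : ℤ) - 1) *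
        q ^ ((b : ℤ) * a + (i : ℤ) * ((i : ℤ) - k)) := by
  set N := a + b + 1 with hN
  have hA : ((a - 1 : ℕ) : ℤ) = (a : ℤ) - 1 := by omega
  have hq := q_ne_zero
  -- first expansion
  have s1 : ∀ r : ℕ,
      qbin a r * qbin b r * qbin ((a : ℤ) + b - r - 1) ((k : ℤ) - r - 1) *
        q ^ ((b : ℤ) * a + (r : ℤ) * ((r : ℤ) - k)) =
      ∑ s ∈ Finset.range N, (qbin b s * qbin ((a : ℤ) - 1) ((k : ℤ) - 1 - s) *
        q ^ ((b : ℤ) * a + (s : ℤ) * ((s : ℤ) - k))) *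
        (qbin s ((s : ℤ) - r) * qbin a r * q ^ (((s : ℤ) - r) * ((a : ℤ) - r))) := by
    intro r
    by_cases hr : r ≤ b
    · have hv := vander (b - r) N r (by omega) (by omega) (a - 1) ((k : ℤ) - 1)
      have hB : ((b - r : ℕ) : ℤ) = (b : ℤ) - r := by omega
      rw [hA, hB] at hv
      rw [show (a : ℤ) + b - r - 1 = a - 1 + (b - r) by ring,
        show (k : ℤ) - r - 1 = k - 1 - r by ring, hv, Finset.mul_sum, Finset.sum_mul]
      refine Finset.sum_congr rfl fun s _ => ?_
      have ht := qbin_trinom b r s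
      rw [← qbin_symm s r] at ht
      have e : q ^ (((s : ℤ) - r) * ((a : ℤ) - 1 - (k - 1) + s)) *
          q ^ ((b : ℤ) * a + (r : ℤ) * ((r : ℤ) - k)) =
          q ^ ((b : ℤ) * a + (s : ℤ) * ((s : ℤ) - k)) * q ^ (((s : ℤ) - r) * ((a : ℤ) - r)) := by
        rw [← zpow_add₀ hq, ← zpow_add₀ hq]; congr 1; ring
      linear_combination
        (qbin a r * qbin b r * qbin ((a : ℤ) - 1) ((k : ℤ) - 1 - s) * qbin (b - r) (s - r)) * e +
        (qbin a r * qbin ((a : ℤ) - 1) ((k : ℤ) - 1 - s) *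
          q ^ ((b : ℤ) * a + (s : ℤ) * ((s : ℤ) - k)) * q ^ (((s : ℤ) - r) * ((a : ℤ) - r))) * ht
    · rw [qbin_zero b r (by omega), Finset.sum_eq_zero]
      · simp
      intro s _
      by_cases hs : s ≤ b
      · rw [qbin_zero s _ (by omega)]; simp
      · rw [qbin_zero b s (by omega)]; simp
  -- second expansion
  have s2 : ∀ s : ℕ,
      (qbin b s * qbin ((a : ℤ) - 1) ((k : ℤ) - 1 - s) *
        q ^ ((b : ℤ) * a + (s : ℤ) * ((s : ℤ) - k))) * qbin ((s : ℤ) + a) s =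
      ∑ i ∈ Finset.range N, (qbin k i * qbin ((a : ℤ) - 1) ((i : ℤ) - 1) *
        q ^ ((b : ℤ) * a + (i : ℤ) * ((i : ℤ) - k))) *
        (qbin ((i : ℤ) - 1) ((k : ℤ) - 1 - s) * qbin b s *
          q ^ ((s : ℤ) * ((i : ℤ) - k + s))) := by
    intro s
    by_cases hs : 0 ≤ (k : ℤ) - 1 - s ∧ (k : ℤ) - 1 - s ≤ a - 1
    · have hv := vander (a + s - k) N ((k : ℤ) - s) (by omega) (by omega) k k
      have hB : ((a + s - k : ℕ) : ℤ) = (a : ℤ) + s - k := by omega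
      rw [hB, show (k : ℤ) + (a + s - k) = s + a by ring, show (k : ℤ) - (k - s) = s by ring] at hv
      rw [hv, Finset.mul_sum]
      refine Finset.sum_congr rfl fun i _ => ?_
      have ht := qbin_trinom ((a : ℤ) - 1) ((k : ℤ) - 1 - s) ((i : ℤ) - 1)
      rw [show (a : ℤ) - 1 - (k - 1 - s) = a + s - k by ring,
        show (i : ℤ) - 1 - (k - 1 - s) = i - (k - s) by ring] at ht
      rw [qbin_symm]
      have e : q ^ (((i : ℤ) - (k - s)) * ((k : ℤ) - k + i)) *
          q ^ ((b : ℤ) * a + (s : ℤ) * ((s : ℤ) - k)) =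
          q ^ ((b : ℤ) * a + (i : ℤ) * ((i : ℤ) - k)) * q ^ ((s : ℤ) * ((i : ℤ) - k + s)) := by
        rw [← zpow_add₀ hq, ← zpow_add₀ hq]; congr 1; ring
      linear_combination
        (qbin b s * qbin ((a : ℤ) - 1) ((k : ℤ) - 1 - s) * qbin k i *
          qbin ((a : ℤ) + s - k) (i - (k - s))) * e +
        (qbin b s * qbin k i * q ^ ((b : ℤ) * a + (i : ℤ) * ((i : ℤ) - k)) *
          q ^ ((s : ℤ) * ((i : ℤ) - k + s))) * ht
    · rw [qbin_zero _ _ hs, Finset.sum_eq_zero]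
      · simp
      intro i _
      have ht := qbin_trinom ((a : ℤ) - 1) ((k : ℤ) - 1 - s) ((i : ℤ) - 1)
      rw [qbin_zero _ _ hs, zero_mul] at ht
      linear_combination (-(qbin b s * qbin k i * q ^ ((b : ℤ) * a + (i : ℤ) * ((i : ℤ) - k)) *
          q ^ ((s : ℤ) * ((i : ℤ) - k + s)))) * ht
  rw [Finset.sum_congr rfl fun r _ => s1 r, Finset.sum_comm]
  simp_rw [← Finset.mul_sum, ← vander' a N (by omega), s2]
  rw [Finset.sum_comm]
  refine Finset.sum_congr rfl fun i _ => ?_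
  rw [← Finset.mul_sum]
  rcases Nat.eq_zero_or_pos i with rfl | hi
  · rw [qbin_zero ((a : ℤ) - 1) _ (by omega)]; simp
  · have hv := vander b N 0 le_rfl (by omega) (i - 1) ((k : ℤ) - 1)
    have hI : ((i - 1 : ℕ) : ℤ) = (i : ℤ) - 1 := by omega
    simp only [hI, sub_zero, show (i : ℤ) - 1 - (k - 1) = i - k by ring] at hv
    rw [← hv, show (b : ℤ) + i - 1 = i - 1 + b by ring]
    ring

/-- Ring hom from `ℕ[X]`. -/
noncomputable def natHom : Polynomial ℕ →+* RatFunc ℚ :=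
  (algebraMap (Polynomial ℚ) (RatFunc ℚ)).comp (Polynomial.mapRingHom (Nat.castRingHom ℚ))

theorem q_mem : q ∈ natHom.rangeS :=
  ⟨Polynomial.X, by simp [natHom, q]⟩

theorem qz_mem (e : ℤ) (he : 0 ≤ e) : q ^ e ∈ natHom.rangeS := by
  obtain ⟨c, rfl⟩ := Int.eq_ofNat_of_zero_le he
  rw [zpow_natCast]
  exact pow_mem q_mem c

theorem qbin_nat_mem (n : ℕ) : ∀ k : ℤ, qbin n k ∈ natHom.rangeS := by
  induction n with
  | zero =>
    intro k
    by_cases h : k = 0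
    · subst h
      rw [qbin_right_zero _ (by omega)]; exact one_mem _
    · rw [qbin_zero _ _ (by omega)]; exact zero_mem _
  | succ n ih =>
    intro k
    push_cast
    by_cases h : 0 ≤ k
    · rw [qbin_pascal]
      exact add_mem (ih _) (mul_mem (qz_mem _ h) (ih _))
    · rw [qbin_zero _ _ (by omega)]; exact zero_mem _

theorem qbin_mem (x y : ℤ) : qbin x y ∈ natHom.rangeS := by
  by_cases h : 0 ≤ x
  · obtain ⟨c, rfl⟩ := Int.eq_ofNat_of_zero_le h
    exact qbin_nat_mem c y
  · rw [qbin_zero _ _ (by omega)]; exact zero_mem _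

theorem term_mem (a b k i : ℕ) (ha : 0 < a) (hk : 0 < k) :
    qint (a + b) / qint k * (qbin k i * qbin ((a : ℤ) - 1) ((i : ℤ) - 1) *
      qbin ((b : ℤ) + i - 1) ((k : ℤ) - 1) *
        q ^ ((b : ℤ) * a + (i : ℤ) * ((i : ℤ) - k))) ∈ natHom.rangeS := by
  by_cases h : 1 ≤ i ∧ i ≤ a ∧ k ≤ b + i
  swap
  · have : qbin ((a : ℤ) - 1) ((i : ℤ) - 1) * qbin ((b : ℤ) + i - 1) ((k : ℤ) - 1) = 0 := by
      by_cases h1 : 1 ≤ i ∧ i ≤ a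
      · rw [qbin_zero ((b : ℤ) + i - 1) _ (by omega), mul_zero]
      · rw [qbin_zero ((a : ℤ) - 1) _ (by omega), zero_mul]
    rw [mul_assoc (qbin k i), this]
    simp [zero_mem]
  obtain ⟨h1, h2, h3⟩ := h
  obtain ⟨d, rfl⟩ := Nat.exists_eq_add_of_le h2
  have he : (0 : ℤ) ≤ (b : ℤ) * ((i + d : ℕ) : ℤ) + (i : ℤ) * ((i : ℤ) - k) := by
    have : (0 : ℤ) ≤ (i : ℤ) * ((b : ℤ) + i - k) := mul_nonneg (by omega) (by omega)
    have h5 : (0 : ℤ) ≤ (b : ℤ) * d := by positivity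
    push_cast
    nlinarith
  have hn : qint (i + d + b) = qint (b + i) + q ^ (b + i) * qint d := by
    rw [← qint_add]; congr 1; ring
  have ab1 := qbin_absorb (b + i) k (by omega) hk
  have ab2 := qbin_absorb2 (i + d) d i h1 rfl
  have ab3 := qbin_absorb k i hk h1
  have hk0 := qint_ne k hk
  rw [Nat.cast_add b i] at ab1
  have key : qint (i + d + b) / qint k * (qbin k i * qbin (((i + d : ℕ) : ℤ) - 1) ((i : ℤ) - 1) *
      qbin ((b : ℤ) + i - 1) ((k : ℤ) - 1) *
        q ^ ((b : ℤ) * ((i + d : ℕ) : ℤ) + (i : ℤ) * ((i : ℤ) - k))) =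
      (qbin k i * qbin (((i + d : ℕ) : ℤ) - 1) ((i : ℤ) - 1) * qbin ((b : ℤ) + i) k +
        q ^ (b + i) * qbin (((i + d : ℕ) : ℤ) - 1) i * qbin ((k : ℤ) - 1) ((i : ℤ) - 1) *
          qbin ((b : ℤ) + i - 1) ((k : ℤ) - 1)) *
        q ^ ((b : ℤ) * ((i + d : ℕ) : ℤ) + (i : ℤ) * ((i : ℤ) - k)) := by
    rw [div_mul_eq_mul_div, div_eq_iff hk0, hn]
    generalize q ^ ((b : ℤ) * ((i + d : ℕ) : ℤ) + (i : ℤ) * ((i : ℤ) - k)) = Q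
    generalize q ^ (b + i) = Q2 at *
    generalize qbin (((i + d : ℕ) : ℤ) - 1) ((i : ℤ) - 1) = A at *
    generalize qbin (((i + d : ℕ) : ℤ) - 1) i = A' at *
    generalize qbin ((b : ℤ) + i - 1) ((k : ℤ) - 1) = B at *
    linear_combination (-(qbin k i * A * Q)) * ab1 - (Q2 * qbin k i * B * Q) * ab2
      + (Q2 * A' * B * Q) * ab3
  rw [key]
  exact mul_mem (add_mem (mul_mem (mul_mem (qbin_mem _ _) (qbin_mem _ _)) (qbin_mem _ _))
    (mul_mem (mul_mem (mul_mem (pow_mem q_mem _) (qbin_mem _ _)) (qbin_mem _ _)) (qbin_mem _ _)))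
    (qz_mem _ he)

theorem gchoose_qpositive (n p k : ℕ) (hn : 0 < n) (hp : 0 < p) (hk : 0 < k) (hpn : p ≤ n) :
    ∃ P : Polynomial ℕ,
      gchoose n p k =
        algebraMap (Polynomial ℚ) (RatFunc ℚ) (P.map (Nat.castRingHom ℚ)) := by
  obtain ⟨b, rfl⟩ := Nat.exists_eq_add_of_le hpn
  have hm : gchoose (p + b) p k ∈ natHom.rangeS := by
    unfold gchoose
    rw [show ((p + b : ℕ) : ℤ) = (p : ℤ) + b by push_cast; ring, add_sub_cancel_left,
      sum_transform p b k hp, Finset.mul_sum]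
    exact sum_mem fun i _ => term_mem p b k i hp hk
  obtain ⟨P, hP⟩ := hm
  exact ⟨P, hP.symm⟩
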